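/- The separating Noether number of C₃ × C₃ over ℝ equals 3: for every finite dimensional real representation of C₃ × C₃, polynomial invariants of degree at most 3 separate the orbits, and degree 2 invariants do not suffice in general. -/

import Mathlib

open MvPolynomial

/-- `SepByDeg n d ρ` : the polynomial invariants of degree at most `d` of the
`n`-dimensional real representation `ρ` of `C₃ × C₃` separate its orbits. -/
def SepByDeg (n d : ℕ)
    (ρ : Multiplicative (ZMod 3 × ZMod 3) →* Matrix (Fin n) (Fin n) ℝ) : Prop :=
  ∀ v w : Fin n → ℝ, (¬ ∃ g, (ρ g).mulVec v = w) →
    ∃ f : MvPolynomial (Fin n) ℝ,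
      (∀ g (u : Fin n → ℝ), eval ((ρ g).mulVec u) f = eval u f) ∧
      f.totalDegree ≤ d ∧ eval v f ≠ eval w f

namespace C3xC3

/-- The group `C₃ × C₃`, written additively. -/
abbrev G : Type := ZMod 3 × ZMod 3

/-- The standard bilinear pairing on `G`. -/
def dot (p g : G) : ZMod 3 := p.1 * g.1 + p.2 * g.2

lemma dot_add (p g h : G) : dot p (g + h) = dot p g + dot p h := by
  simp only [dot, Prod.fst_add, Prod.snd_add]; ring

lemma add_dot (p q g : G) : dot (p + q) g = dot p g + dot q g := by
  simp only [dot, Prod.fst_add, Prod.snd_add]; ring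

lemma neg_dot (p g : G) : dot (-p) g = -dot p g := by
  simp only [dot, Prod.fst_neg, Prod.snd_neg]; ring

lemma sum_dot {κ : Type*} (s : Finset κ) (p : κ → G) (g : G) :
    dot (∑ k ∈ s, p k) g = ∑ k ∈ s, dot (p k) g := by
  simp only [dot, Prod.fst_sum, Prod.snd_sum, Finset.sum_mul, Finset.sum_add_distrib]

/-- The standard additive character of `ℤ/3ℤ`. -/
noncomputable abbrev ζ : AddChar (ZMod 3) ℂ := ZMod.stdAddChar

lemma conj_ζ (x : ZMod 3) : (starRingEnd ℂ) (ζ x) = ζ (-x) := by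
  rw [AddChar.map_neg_eq_conj]

lemma exists_ζ_eq {z : ℂ} (hz : z ^ 3 = 1) : ∃ c, z = ζ c := by
  have h : IsPrimitiveRoot (ζ 1) 3 := by
    have := Complex.isPrimitiveRoot_exp 3 (by norm_num)
    convert this using 1
    have := ZMod.stdAddChar_coe (N := 3) 1
    simpa using this
  obtain ⟨i, -, hi⟩ := h.eq_pow_of_pow_eq_one hz
  refine ⟨(i : ZMod 3), ?_⟩
  rw [← hi, ← AddChar.map_nsmul_eq_pow]
  simp

lemma sum_ζ_dot (g : G) : ∑ p : G, ζ (dot p g) = if g = 0 then 9 else 0 := by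
  have h (b : ZMod 3) := AddChar.sum_mulShift b (ZMod.isPrimitive_stdAddChar 3)
  simp only [dot, AddChar.map_add_eq_mul, Fintype.sum_prod_type, ← Finset.mul_sum,
    ← Finset.sum_mul]
  rw [h, h]
  by_cases h1 : g.1 = 0 <;> by_cases h2 : g.2 = 0 <;> simp [h1, h2, Prod.ext_iff]
  norm_num

lemma ζ_sum {κ : Type*} (s : Finset κ) (x : κ → ZMod 3) : ζ (∑ k ∈ s, x k) = ∏ k ∈ s, ζ (x k) :=
  map_prod ζ.toMonoidHom (fun k => Multiplicative.ofAdd (x k)) s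

/-- The (unnormalised) Fourier transform on `G`. -/
noncomputable def fourier (f : G → ℝ) (p : G) : ℂ := ∑ g, ζ (dot p g) * f g

lemma fourier_neg (f : G → ℝ) (p : G) :
    fourier f (-p) = (starRingEnd ℂ) (fourier f p) := by
  simp [fourier, map_sum, neg_dot, conj_ζ]

lemma fourier_translate (f : G → ℝ) (h p : G) :
    fourier (fun g => f (g - h)) p = ζ (dot p h) * fourier f p := by
  unfold fourier
  rw [← Equiv.sum_comp (Equiv.addRight h), Finset.mul_sum]
  refine Finset.sum_congr rfl fun g _ => ?_
  simp only [Equiv.coe_addRight, add_sub_cancel_right, dot_add, AddChar.map_add_eq_mul]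
  ring

lemma sum_ζ_mul_fourier (f : G → ℝ) (g : G) :
    ∑ p, ζ (dot p (-g)) * fourier f p = 9 * f g := by
  simp only [fourier, Finset.mul_sum]
  rw [Finset.sum_comm]
  have h (x : G) : ∑ p, ζ (dot p (-g)) * (ζ (dot p x) * f x)
      = (if x = g then 9 else 0) * f x := by
    simp only [← mul_assoc, ← AddChar.map_add_eq_mul, ← dot_add, ← Finset.sum_mul, sum_ζ_dot,
      neg_add_eq_zero, eq_comm]
  simp [h]

lemma fourier_injective : Function.Injective fourier := by
  intro f f' h
  funext g
  have h1 := sum_ζ_mul_fourier f g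
  rw [h, sum_ζ_mul_fourier f' g] at h1
  exact_mod_cast (mul_left_cancel₀ (by norm_num) h1).symm

/-- The polynomial orbit-sum functions of the family `F`, of degree `d`. -/
def orbitSum {ι : Type*} (F : ι → G → ℝ) {d : ℕ} (i : Fin d → ι) (s : Fin d → G) : ℝ :=
  ∑ g, ∏ k, F (i k) (s k + g)

lemma prod_fourier {ι : Type*} (F : ι → G → ℝ) {d : ℕ} (i : Fin d → ι) (p : Fin d → G)
    (hp : ∑ k, p k = 0) :
    9 * ∏ k, fourier (F (i k)) (p k)
      = ∑ x : Fin d → G, (∏ k, ζ (dot (p k) (x k))) * (orbitSum F i x : ℂ) := by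
  have key (g : G) : ∏ k, fourier (F (i k)) (p k)
      = ∑ x : Fin d → G, (∏ k, ζ (dot (p k) (x k))) * ∏ k, (F (i k) (x k + g) : ℂ) := by
    simp only [fourier]
    rw [Finset.prod_univ_sum, Fintype.piFinset_univ,
      ← Equiv.sum_comp (Equiv.addRight (fun _ : Fin d => g))]
    refine Finset.sum_congr rfl fun x _ => ?_
    have h0 : ∏ k, ζ (dot (p k) g) = 1 := by
      rw [← ζ_sum, ← sum_dot, hp]; simp [dot]
    simp only [Equiv.coe_addRight, Pi.add_apply, dot_add, AddChar.map_add_eq_mul,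
      Finset.prod_mul_distrib, h0, mul_one]
  calc 9 * ∏ k, fourier (F (i k)) (p k) = ∑ g : G, ∏ k, fourier (F (i k)) (p k) := by
        simp
    _ = ∑ g : G, ∑ x : Fin d → G,
          (∏ k, ζ (dot (p k) (x k))) * ∏ k, (F (i k) (x k + g) : ℂ) :=
        Finset.sum_congr rfl fun g _ => key g
    _ = _ := by
        rw [Finset.sum_comm]
        simp [orbitSum, Finset.mul_sum]

set_option synthInstance.maxSize 1024 in
lemma exists_dot_eq {p q : G} (hp : p ≠ 0) (h0 : q ≠ 0) (h1 : q ≠ p) (h2 : q ≠ -p)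
    (x y : ZMod 3) : ∃ h, dot p h = x ∧ dot q h = y := by
  have hd : p.1 * q.2 - p.2 * q.1 ≠ 0 := by
    clear x y
    revert p q; decide
  have hd2 : (p.1 * q.2 - p.2 * q.1) ^ 2 = 1 := by
    generalize p.1 * q.2 - p.2 * q.1 = d at hd
    revert d; decide
  refine ⟨((p.1 * q.2 - p.2 * q.1) * (q.2 * x - p.2 * y),
    (p.1 * q.2 - p.2 * q.1) * (p.1 * y - q.1 * x)), ?_, ?_⟩
  · simp only [dot]; linear_combination x * hd2
  · simp only [dot]; linear_combination y * hd2

lemma exists_dot_eq_single {p : G} (hp : p ≠ 0) (x : ZMod 3) : ∃ h, dot p h = x := by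
  revert p x; decide

lemma mem_span_pair {p q : G} (hp : p ≠ 0) (h0 : q ≠ 0) (h1 : q ≠ p) (h2 : q ≠ -p) (r : G) :
    r = 0 ∨ r = p ∨ r = -p ∨ r = q ∨ r = -q ∨ p + q + -r = 0 ∨ p + -q + -r = 0 ∨
      -p + q + -r = 0 ∨ -p + -q + -r = 0 := by
  revert p q r; decide

/-- A partial function on `G` that is odd and additive where defined is a linear form. -/
lemma exists_dot_of_additive (S : Set G) (c : G → ZMod 3)
    (hS : ∀ p ∈ S, -p ∈ S) (hzero : (0 : G) ∈ S → c 0 = 0)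
    (hneg : ∀ p ∈ S, c (-p) = -c p)
    (hadd : ∀ p ∈ S, ∀ q ∈ S, ∀ r ∈ S, p + q + r = 0 → c p + c q + c r = 0) :
    ∃ h, ∀ p ∈ S, c p = dot p h := by
  by_cases hp : ∃ p ∈ S, p ≠ 0
  swap
  · push Not at hp
    refine ⟨0, fun p h => ?_⟩
    obtain rfl := hp p h
    simp [hzero h, dot]
  obtain ⟨p, hpS, hp⟩ := hp
  by_cases hq : ∃ q ∈ S, q ≠ 0 ∧ q ≠ p ∧ q ≠ -p
  · obtain ⟨q, hqS, h0, h1, h2⟩ := hq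
    obtain ⟨h, hhp, hhq⟩ := exists_dot_eq hp h0 h1 h2 (c p) (c q)
    refine ⟨h, fun r hr => ?_⟩
    have hnp := hneg p hpS
    have hnq := hneg q hqS
    have hnr := hneg r hr
    have solve {p' q' : G} (hp' : p' ∈ S) (hq' : q' ∈ S) (hcp : c p' = dot p' h)
        (hcq : c q' = dot q' h) (e : p' + q' + -r = 0) : c r = dot r h := by
      have e' := hadd p' hp' q' hq' (-r) (hS r hr) e
      rw [← sub_eq_add_neg, sub_eq_zero] at e
      rw [← e, add_dot, e, ← hcp, ← hcq]
      linear_combination -e' + hnr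
    have hcnp : c (-p) = dot (-p) h := by rw [neg_dot, hhp, hnp]
    have hcnq : c (-q) = dot (-q) h := by rw [neg_dot, hhq, hnq]
    rcases mem_span_pair hp h0 h1 h2 r with
      rfl | rfl | rfl | rfl | rfl | e | e | e | e
    · simp [hzero hr, dot]
    · exact hhp.symm
    · exact hcnp
    · exact hhq.symm
    · exact hcnq
    · exact solve hpS hqS hhp.symm hhq.symm e
    · exact solve hpS (hS q hqS) hhp.symm hcnq e
    · exact solve (hS p hpS) hqS hcnp hhq.symm e
    · exact solve (hS p hpS) (hS q hqS) hcnp hcnq e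
  · push Not at hq
    obtain ⟨h, hh⟩ := exists_dot_eq_single hp (c p)
    refine ⟨h, fun r hr => ?_⟩
    by_cases r0 : r = 0
    · subst r0; simp [hzero hr, dot]
    by_cases r1 : r = p
    · rw [r1, hh]
    · rw [hq r hr r0 r1, hneg p hpS, neg_dot, hh]

/-- Two families of real functions on `G` with the same orbit sums of degree at most three
are translates of each other. -/
theorem exists_translate {ι : Type*} (F H : ι → G → ℝ)
    (hFH : ∀ d ≤ 3, ∀ (i : Fin d → ι) (s : Fin d → G), orbitSum F i s = orbitSum H i s) :
    ∃ h, ∀ i g, H i g = F i (g - h) := by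
  have hprod {d : ℕ} (hd : d ≤ 3) (i : Fin d → ι) (p : Fin d → G) (hp : ∑ k, p k = 0) :
      ∏ k, fourier (F (i k)) (p k) = ∏ k, fourier (H (i k)) (p k) := by
    refine mul_left_cancel₀ (a := (9 : ℂ)) (by norm_num) ?_
    simp only [prod_fourier _ _ _ hp, hFH d hd]
  have h1 (i : ι) : fourier (F i) 0 = fourier (H i) 0 := by
    simpa using hprod (d := 1) (by norm_num) ![i] ![0] (by simp)
  have h2 (i j : ι) (p : G) : fourier (F i) p * (starRingEnd ℂ) (fourier (F j) p)
      = fourier (H i) p * (starRingEnd ℂ) (fourier (H j) p) := by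
    simpa [Fin.prod_univ_two, fourier_neg] using
      hprod (d := 2) (by norm_num) ![i, j] ![p, -p] (by simp)
  have h3 (i j k : ι) (p q r : G) (h : p + q + r = 0) :
      fourier (F i) p * fourier (F j) q * fourier (F k) r
        = fourier (H i) p * fourier (H j) q * fourier (H k) r := by
    simpa [Fin.prod_univ_three] using
      hprod (d := 3) le_rfl ![i, j, k] ![p, q, r] (by simpa [Fin.sum_univ_three] using h)
  have hphase (p : G) : ∃ c, ∀ i, fourier (H i) p = ζ c * fourier (F i) p := by
    by_cases hS : ∃ j, fourier (F j) p ≠ 0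
    · obtain ⟨j, hj⟩ := hS
      have hj' : fourier (H j) p ≠ 0 := by
        intro h0
        have := h2 j j p
        simp [h0, hj] at this
      have hcube : (fourier (H j) p / fourier (F j) p) ^ 3 = 1 := by
        have h3p : p + p + p = 0 := by clear hj hj'; revert p; decide
        have := h3 j j j p p p h3p
        field_simp
        linear_combination -this
      obtain ⟨c, hc⟩ := exists_ζ_eq hcube
      have hcj : fourier (H j) p = ζ c * fourier (F j) p := by rw [← hc]; field_simp
      refine ⟨c, fun i => ?_⟩
      have h := h2 i j p
      rw [hcj, map_mul, conj_ζ] at h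
      have hcc : ζ c * ζ (-c) = 1 := by rw [← AddChar.map_add_eq_mul]; simp
      refine mul_right_cancel₀ ((map_ne_zero (starRingEnd ℂ)).2 hj) ?_
      linear_combination -ζ c * h - fourier (H i) p * (starRingEnd ℂ) (fourier (F j) p) * hcc
    · push Not at hS
      refine ⟨0, fun i => ?_⟩
      have := h2 i i p
      simp only [hS, zero_mul] at this
      simpa [hS] using this.symm
  choose c hc using hphase
  have hinj : Function.Injective ζ := ZMod.injective_stdAddChar
  obtain ⟨h, hh⟩ : ∃ h, ∀ p ∈ {p | ∃ i, fourier (F i) p ≠ 0}, c p = dot p h := by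
    apply exists_dot_of_additive
    · rintro p ⟨i, hi⟩
      exact ⟨i, by simpa [fourier_neg] using hi⟩
    · rintro ⟨i, hi⟩
      have := hc 0 i
      rw [← h1 i] at this
      apply hinj
      rw [AddChar.map_zero_eq_one]
      exact mul_right_cancel₀ hi (by rw [one_mul, ← this])
    · rintro p ⟨i, hi⟩
      have := hc (-p) i
      rw [fourier_neg, fourier_neg, hc p i, map_mul, conj_ζ] at this
      exact (hinj (mul_right_cancel₀ ((map_ne_zero (starRingEnd ℂ)).2 hi) this)).symm
    · rintro p ⟨i, hi⟩ q ⟨j, hj⟩ r ⟨k, hk⟩ e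
      have := h3 i j k p q r e
      rw [hc p i, hc q j, hc r k] at this
      apply hinj
      rw [AddChar.map_zero_eq_one, AddChar.map_add_eq_mul, AddChar.map_add_eq_mul]
      refine mul_right_cancel₀ (mul_ne_zero (mul_ne_zero hi hj) hk) ?_
      linear_combination -this
  refine ⟨h, fun i g => ?_⟩
  refine congrFun (fourier_injective ?_ : H i = fun g => F i (g - h)) g
  funext p
  rw [fourier_translate, hc p i]
  by_cases hi : fourier (F i) p = 0
  · simp [hi]
  · rw [hh p ⟨i, hi⟩]

/-- The linear form with coefficient vector `a`. -/
noncomputable def linearForm {n : ℕ} (a : Fin n → ℝ) : MvPolynomial (Fin n) ℝ :=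
  ∑ j, C (a j) * X j

lemma eval_linearForm {n : ℕ} (a u : Fin n → ℝ) : eval u (linearForm a) = a ⬝ᵥ u := by
  simp [linearForm, dotProduct]

lemma totalDegree_linearForm_le {n : ℕ} (a : Fin n → ℝ) : (linearForm a).totalDegree ≤ 1 := by
  refine totalDegree_finsetSum_le fun j _ => ?_
  refine (totalDegree_mul _ _).trans ?_
  simp

variable {n : ℕ} (ρ : Multiplicative G →* Matrix (Fin n) (Fin n) ℝ)

/-- The coordinates of the points of the orbit of `u`, as functions on `G`. -/
def orbitCoord (u : Fin n → ℝ) (i : Fin n) (g : G) : ℝ :=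
  (ρ (Multiplicative.ofAdd g)).mulVec u i

lemma orbitCoord_mulVec (u : Fin n → ℝ) (i : Fin n) (g h : G) :
    orbitCoord ρ ((ρ (Multiplicative.ofAdd h)).mulVec u) i g = orbitCoord ρ u i (g + h) := by
  simp [orbitCoord, Matrix.mulVec_mulVec, ofAdd_add]

/-- The invariant polynomial whose values are orbit sums. -/
noncomputable def orbitSumPoly {d : ℕ} (i : Fin d → Fin n) (s : Fin d → G) :
    MvPolynomial (Fin n) ℝ :=
  ∑ g, ∏ k, linearForm (ρ (Multiplicative.ofAdd (s k + g)) (i k))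

lemma eval_orbitSumPoly {d : ℕ} (i : Fin d → Fin n) (s : Fin d → G) (u : Fin n → ℝ) :
    eval u (orbitSumPoly ρ i s) = orbitSum (orbitCoord ρ u) i s := by
  simp only [orbitSumPoly, orbitSum, map_sum, map_prod, eval_linearForm]
  rfl

lemma totalDegree_orbitSumPoly_le {d : ℕ} (i : Fin d → Fin n) (s : Fin d → G) :
    (orbitSumPoly ρ i s).totalDegree ≤ d := by
  refine totalDegree_finsetSum_le fun g _ => ?_
  refine (totalDegree_finsetProd _ _).trans ?_
  refine (Finset.sum_le_sum fun k _ => totalDegree_linearForm_le _).trans ?_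
  simp

lemma eval_mulVec_orbitSumPoly {d : ℕ} (i : Fin d → Fin n) (s : Fin d → G)
    (h : Multiplicative G) (u : Fin n → ℝ) :
    eval ((ρ h).mulVec u) (orbitSumPoly ρ i s) = eval u (orbitSumPoly ρ i s) := by
  obtain ⟨h, rfl⟩ := Multiplicative.ofAdd.surjective h
  simp only [eval_orbitSumPoly, orbitSum, orbitCoord_mulVec, add_assoc]
  exact Equiv.sum_comp (Equiv.addRight h) (fun g => ∏ k, orbitCoord ρ u (i k) (s k + g))

theorem sepByDeg_three : SepByDeg n 3 ρ := by
  intro v w hvw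
  by_contra! hf
  obtain ⟨h, hh⟩ := exists_translate (orbitCoord ρ v) (orbitCoord ρ w) fun d hd i s => by
    rw [← eval_orbitSumPoly, ← eval_orbitSumPoly]
    exact hf _ (eval_mulVec_orbitSumPoly ρ i s) ((totalDegree_orbitSumPoly_le ρ i s).trans hd)
  refine hvw ⟨Multiplicative.ofAdd (-h), funext fun i => ?_⟩
  simpa [orbitCoord] using (hh i 0).symm

/-- The representation on `ℝ³` through cyclic permutations by the first factor. -/
def cyclicRep : Multiplicative G →* Matrix (Fin 3) (Fin 3) ℝ where
  toFun g := Matrix.of fun i j =>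
    if j = i + (ZMod.finEquiv 3).symm (Multiplicative.toAdd g).1 then 1 else 0
  map_one' := by
    ext i j
    simp [Matrix.one_apply, eq_comm]
  map_mul' g h := by
    ext i j
    simp only [Matrix.mul_apply, Matrix.of_apply, ite_mul, one_mul, zero_mul,
      Finset.sum_ite_eq', Finset.mem_univ, if_true, toAdd_mul, Prod.fst_add]
    exact if_congr (by rw [map_add, add_assoc]) rfl rfl

lemma cyclicRep_mulVec (g : Multiplicative G) (u : Fin 3 → ℝ) :
    (cyclicRep g).mulVec u = fun i =>
      u (i + (ZMod.finEquiv 3).symm (Multiplicative.toAdd g).1) := by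
  funext i
  simp [cyclicRep, Matrix.mulVec, dotProduct]

/-- A polynomial of degree at most two has vanishing alternating sum over `S₃`. -/
lemma eval_alternating_eq {f : MvPolynomial (Fin 3) ℝ} (hf : f.totalDegree ≤ 2) (a b c : ℝ) :
    eval ![a, b, c] f + eval ![b, c, a] f + eval ![c, a, b] f
      = eval ![b, a, c] f + eval ![a, c, b] f + eval ![c, b, a] f := by
  simp only [eval_eq', ← Finset.sum_add_distrib]
  refine Finset.sum_congr rfl fun m hm => ?_
  have hdeg : m 0 + m 1 + m 2 ≤ 2 := by
    have := (le_totalDegree hm).trans hf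
    rwa [Finsupp.sum_fintype _ _ (fun _ => rfl), Fin.sum_univ_three] at this
  simp only [Fin.prod_univ_three, Matrix.cons_val]
  generalize m 0 = x, m 1 = y, m 2 = z at hdeg
  have hx : x ≤ 2 := by omega
  have hy : y ≤ 2 := by omega
  have hz : z ≤ 2 := by omega
  interval_cases x <;> interval_cases y <;> interval_cases z <;> first | omega | ring

theorem not_sepByDeg_two_cyclicRep : ¬ SepByDeg 3 2 cyclicRep := by
  intro h
  obtain ⟨f, hinv, hdeg, hne⟩ := h ![0, 1, 2] ![1, 0, 2] (by
    rintro ⟨g, hg⟩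
    rw [cyclicRep_mulVec] at hg
    generalize (ZMod.finEquiv 3).symm (Multiplicative.toAdd g).1 = x at hg
    have h0 := congrFun hg 0
    have h1 := congrFun hg 1
    fin_cases x <;> simp at h0 h1)
  have hrot (a b c : ℝ) : eval ![b, c, a] f = eval ![a, b, c] f := by
    rw [← hinv (Multiplicative.ofAdd (1, 0)) ![a, b, c], cyclicRep_mulVec]
    congr 2
    funext i
    fin_cases i <;> rfl
  have := eval_alternating_eq hdeg 0 1 2
  apply hne
  linarith [hrot 0 1 2, hrot 1 2 0, hrot 1 0 2, hrot 0 2 1]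

end C3xC3

/-- The separating Noether number of `C₃ × C₃` over `ℝ` equals `3`. -/
theorem sepNoetherNumber_R_C3xC3 :
    (∀ (n : ℕ) (ρ : Multiplicative (ZMod 3 × ZMod 3) →* Matrix (Fin n) (Fin n) ℝ)
        (hρ : ∀ g, IsUnit (ρ g)), SepByDeg n 3 ρ) ∧
    ¬ (∀ (n : ℕ) (ρ : Multiplicative (ZMod 3 × ZMod 3) →* Matrix (Fin n) (Fin n) ℝ)
        (hρ : ∀ g, IsUnit (ρ g)), SepByDeg n 2 ρ) := by
  refine ⟨fun n ρ _ => C3xC3.sepByDeg_three ρ, fun h => ?_⟩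
  exact C3xC3.not_sepByDeg_two_cyclicRep (h 3 C3xC3.cyclicRep fun g => (Group.isUnit g).map _)
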